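/- Let P : Fin n → ℝ² be a configuration of n labeled points (injective, in general position), and let a, b, c be pairwise distinct indices with χ_P(b,c,a) = +1 such that the closed triangle with vertices P a, P b, P c contains no point P x with x ∉ {a,b,c} (the triangle ⟨a,b,c⟩ is empty). Let P_b := {x ∉ {a,b,c} | χ_P(b,c,x) = −1 ∧ χ_P(a,b,x) = −1} (the indices of points strictly to the right of the directed line bc and strictly to the right of the directed line ab), and let P_bc := {x ≠ b, c | χ_P(b,c,x) = +1} (the indices of points strictly to the left of the directed line bc; note a ∈ P_bc). Suppose there exist distinct v, w ∈ P_bc such that the line through P v and P w does not intersect the closed segment [P b, P c]. Then for every b' ∈ P_b ∪ {b} there exist distinct v', w' ∈ P_bc such that: the line through P v' and P w' does not intersect the closed segment [P b, P c], and v', w' are angularly consecutive among P_bc as seen from P b', meaning that there is no u ∈ P_bc with u ∉ {v', w'} satisfying χ_P(b',v',u) = χ_P(b',v',w') and χ_P(b',u,w') = χ_P(b',v',w'). -/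

import Mathlib

noncomputable def det2 (v w : ℝ × ℝ) : ℝ := v.1 * w.2 - v.2 * w.1

noncomputable def chi {α : Type*} (P : α → ℝ × ℝ) (i j k : α) : ℝ :=
  Real.sign (det2 (P j - P i) (P k - P i))

def GenPos {α : Type*} (P : α → ℝ × ℝ) : Prop :=
  ∀ i j k : α, i ≠ j → i ≠ k → j ≠ k → chi P i j k ≠ 0

def Ccw {α : Type*} (P : α → ℝ × ℝ) (i j k l : α) : Prop :=
  (chi P i j k = 1 ∧ chi P i k l = 1) ∨
  (chi P i k l = 1 ∧ chi P i l j = 1) ∨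
  (chi P i l j = 1 ∧ chi P i j k = 1)

def Admissible {α : Type*} (i j k l : α) : Prop :=
  i ≠ j ∧ i ≠ k ∧ i ≠ l ∧ j ≠ k ∧ j ≠ l ∧ k ≠ l

def SameRadial {α : Type*} (P Q : α → ℝ × ℝ) : Prop :=
  ∀ i j k l : α, Admissible i j k l → (Ccw P i j k l ↔ Ccw Q i j k l)

def SameUndirected {α : Type*} (P Q : α → ℝ × ℝ) : Prop :=
  ∀ i : α, (∀ j k l : α, Admissible i j k l → (Ccw Q i j k l ↔ Ccw P i j k l)) ∨
           (∀ j k l : α, Admissible i j k l → (Ccw Q i j k l ↔ Ccw P i l k j))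

def ExtremeSet {α : Type*} (P : α → ℝ × ℝ) : Set α :=
  {i | P i ∉ convexHull ℝ (P '' {j | j ≠ i})}

def Important {n : ℕ} (P₀ : Fin n → ℝ × ℝ) (H : Set (Fin n)) : Prop :=
  ∃ Q : Fin n → ℝ × ℝ, Function.Injective Q ∧ GenPos Q ∧ SameRadial P₀ Q ∧ ExtremeSet Q = H

def lineThrough (p q : ℝ × ℝ) : Set (ℝ × ℝ) := {x | ∃ t : ℝ, x = p + t • (q - p)}

/-- Twice the signed area of the triangle `p q r`. -/
noncomputable def orient (p q r : ℝ × ℝ) : ℝ := det2 (q - p) (r - p)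

theorem chi_eq_one_iff {α : Type*} {P : α → ℝ × ℝ} {i j k : α} :
    chi P i j k = 1 ↔ 0 < orient (P i) (P j) (P k) := by
  change Real.sign (orient (P i) (P j) (P k)) = 1 ↔ _
  rcases lt_trichotomy (orient (P i) (P j) (P k)) 0 with h | h | h
  · rw [Real.sign_of_neg h]
    constructor <;> intro h' <;> linarith
  · simp [h]
  · simp [Real.sign_of_pos h, h]

theorem chi_eq_neg_one_iff {α : Type*} {P : α → ℝ × ℝ} {i j k : α} :
    chi P i j k = -1 ↔ orient (P i) (P j) (P k) < 0 := by
  change Real.sign (orient (P i) (P j) (P k)) = -1 ↔ _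
  rcases lt_trichotomy (orient (P i) (P j) (P k)) 0 with h | h | h
  · simp [Real.sign_of_neg h, h]
  · simp [h]
  · rw [Real.sign_of_pos h]
    constructor <;> intro h' <;> linarith

theorem GenPos.orient_ne_zero {α : Type*} {P : α → ℝ × ℝ} (hP : GenPos P) {i j k : α}
    (hij : i ≠ j) (hik : i ≠ k) (hjk : j ≠ k) : orient (P i) (P j) (P k) ≠ 0 := by
  intro h
  apply hP i j k hij hik hjk
  change Real.sign (orient (P i) (P j) (P k)) = 0
  simp [h]

theorem orient_swap (p q r : ℝ × ℝ) : orient p r q = -orient p q r := by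
  simp only [orient, det2]
  ring

/-- The angular order around a point `k` is transitive on an open half-plane not containing
`k`. -/
theorem orient_trans {b c k x y z : ℝ × ℝ} (hk : orient b c k ≤ 0) (hx : 0 < orient b c x)
    (hy : 0 < orient b c y) (hz : 0 < orient b c z) (hxy : 0 < orient k x y)
    (hyz : 0 < orient k y z) : 0 < orient k x z := by
  have key : (orient b c y - orient b c k) * orient k x z =
      (orient b c x - orient b c k) * orient k y z +
        (orient b c z - orient b c k) * orient k x y := by
    simp only [orient, det2, Prod.fst_sub, Prod.snd_sub]
    ring
  have h₁ := mul_pos (sub_pos.2 (hk.trans_lt hx)) hyz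
  have h₂ := mul_pos (sub_pos.2 (hk.trans_lt hz)) hxy
  exact pos_of_mul_pos_right (by linarith) (sub_pos.2 (hk.trans_lt hy)).le

theorem lineThrough_comm (p q : ℝ × ℝ) : lineThrough p q = lineThrough q p := by
  ext x
  constructor <;> rintro ⟨t, rfl⟩ <;> exact ⟨1 - t, by module⟩

theorem orient_mul_nonpos_of_inter_nonempty {v w b c : ℝ × ℝ}
    (h : (lineThrough v w ∩ segment ℝ b c).Nonempty) :
    orient b v w * orient c v w ≤ 0 := by
  obtain ⟨q, ⟨t, ht⟩, s₁, s₂, h₁, h₂, hs, hq⟩ := h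
  rw [ht] at hq
  have e₁ := congrArg Prod.fst hq
  have e₂ := congrArg Prod.snd hq
  simp only [Prod.fst_add, Prod.snd_add, Prod.smul_fst, Prod.smul_snd, Prod.fst_sub,
    Prod.snd_sub, smul_eq_mul] at e₁ e₂
  have key : s₁ * orient b v w + s₂ * orient c v w = 0 := by
    simp only [orient, det2, Prod.fst_sub, Prod.snd_sub]
    obtain rfl : s₁ = 1 - s₂ := by linarith
    linear_combination (v.2 - w.2) * e₁ - (v.1 - w.1) * e₂
  by_contra! hpos
  rcases pos_and_pos_or_neg_and_neg_of_mul_pos hpos with ⟨hb, hc⟩ | ⟨hb, hc⟩ <;>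
    rcases h₁.eq_or_lt with rfl | h₁ <;> nlinarith

theorem inter_nonempty_of_orient {v w b c : ℝ × ℝ} (hb : 0 < orient b v w)
    (hc : orient c v w < 0) : (lineThrough v w ∩ segment ℝ b c).Nonempty := by
  have hd : orient b v w - orient c v w = orient b c w - orient b c v := by
    simp only [orient, det2, Prod.fst_sub, Prod.snd_sub]
    ring
  have hpos : 0 < orient b v w - orient c v w := by linarith
  refine ⟨v + (-orient b c v / (orient b v w - orient c v w)) • (w - v), ⟨_, rfl⟩,
    -orient c v w / (orient b v w - orient c v w), orient b v w / (orient b v w - orient c v w),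
    div_nonneg (by linarith) hpos.le, div_nonneg hb.le hpos.le, ?_, ?_⟩
  · field_simp
    ring
  · ext <;>
    · simp only [Prod.fst_add, Prod.snd_add, Prod.smul_fst, Prod.smul_snd, Prod.fst_sub,
        Prod.snd_sub, smul_eq_mul]
      field_simp
      simp only [orient, det2, Prod.fst_sub, Prod.snd_sub]
      ring

theorem mem_convexHull_triple {a b c x : ℝ × ℝ} (hΔ : 0 < orient b c a)
    (h₁ : 0 ≤ orient b x a) (h₂ : 0 ≤ orient b c x) (h₃ : orient c x a ≤ 0) :
    x ∈ convexHull ℝ ({a, b, c} : Set (ℝ × ℝ)) := by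
  have hsum : orient b c x - orient c x a + orient b x a = orient b c a := by
    simp only [orient, det2, Prod.fst_sub, Prod.snd_sub]
    ring
  have hx : x = (orient b c x / orient b c a) • a + (-orient c x a / orient b c a) • b +
      (orient b x a / orient b c a) • c := by
    ext <;>
    · simp only [Prod.fst_add, Prod.snd_add, Prod.smul_fst, Prod.smul_snd, smul_eq_mul]
      field_simp
      simp only [orient, det2, Prod.fst_sub, Prod.snd_sub]
      ring
  have hconv := (convex_convexHull ℝ ({a, b, c} : Set (ℝ × ℝ))).sum_mem
    (t := Finset.univ)
    (w := ![orient b c x / orient b c a, -orient c x a / orient b c a,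
      orient b x a / orient b c a]) (z := ![a, b, c])
    (by
      intro i _
      fin_cases i
      · exact div_nonneg h₂ hΔ.le
      · exact div_nonneg (neg_nonneg.2 h₃) hΔ.le
      · exact div_nonneg h₁ hΔ.le)
    (by
      simp only [Fin.sum_univ_three, Matrix.cons_val]
      field_simp
      linarith)
    (by
      intro i _
      apply subset_convexHull
      fin_cases i <;> simp)
  simp only [Fin.sum_univ_three, Matrix.cons_val] at hconv
  rwa [hx]

/-- If `b'` lies in the cone opposite to the triangle `a b c` at `b`, and the line `v w`
separates `b` from both `b'` and `c`, then `v` and `w` both precede `a` as seen from `b`. -/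
theorem orient_pos_of_separates {a b c b' v w : ℝ × ℝ} (ha : 0 < orient b c a)
    (h₁ : orient b c b' < 0) (h₂ : orient a b b' < 0)
    (hw : 0 < orient b c w) (hb' : 0 < orient b' v w) (hb : orient b v w < 0)
    (hc : 0 < orient c v w) : 0 < orient b v a ∧ 0 < orient b w a := by
  have e₁ : orient b c a * orient b v w =
      orient b v a * orient b c w - orient b c v * orient b w a := by
    simp only [orient, det2, Prod.fst_sub, Prod.snd_sub]
    ring
  have e₂ : orient c v w = orient b v w - orient b c w + orient b c v := by
    simp only [orient, det2, Prod.fst_sub, Prod.snd_sub]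
    ring
  have e₃ : orient b c a * orient b' v w = orient b c a * orient b v w
      - orient b c b' * (orient b v a - orient b w a)
      - orient a b b' * (orient b c w - orient b c v) := by
    simp only [orient, det2, Prod.fst_sub, Prod.snd_sub]
    ring
  have hlt : orient b c w < orient b c v := by linarith
  have i₁ := mul_neg_of_pos_of_neg ha hb
  have i₂ := mul_pos ha hb'
  have i₃ := mul_pos_of_neg_of_neg h₂ (sub_neg.2 hlt)
  have hx : orient b w a < orient b v a := by
    by_contra! h
    have := mul_nonneg_of_nonpos_of_nonpos h₁.le (sub_nonpos.2 h)
    linarith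
  have hwa : 0 < orient b w a := by
    by_contra! h
    nlinarith [mul_pos (sub_pos.2 hx) hw, mul_nonneg (neg_nonneg.2 h) (sub_pos.2 hlt).le]
  exact ⟨hwa.trans hx, hwa⟩

/-- The relation of being consecutive elements of `S` with respect to `r`. -/
def ConsecutiveIn {ι : Type*} (S : Finset ι) (r : ι → ι → Prop) (x y : ι) : Prop :=
  x ∈ S ∧ y ∈ S ∧ r x y ∧ ∀ t ∈ S, r x t → ¬ r t y

theorem transGen_consecutiveIn {ι : Type*} {S : Finset ι} {r : ι → ι → Prop}
    (hirr : ∀ x ∈ S, ¬ r x x)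
    (htrans : ∀ x ∈ S, ∀ y ∈ S, ∀ z ∈ S, r x y → r y z → r x z) {x y : ι}
    (hx : x ∈ S) (hy : y ∈ S) (hxy : r x y) : Relation.TransGen (ConsecutiveIn S r) x y := by
  classical
  induction hm : (S.filter fun t => r x t ∧ r t y).card using Nat.strong_induction_on
    generalizing x y with
  | _ m ih =>
    subst hm
    by_cases h : ∀ t ∈ S, r x t → ¬ r t y
    · exact .single ⟨hx, hy, hxy, h⟩
    push Not at h
    obtain ⟨u, hu, hxu, huy⟩ := h
    refine (ih _ ?_ hx hu hxu rfl).trans (ih _ ?_ hu hy huy rfl) <;>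
      refine Finset.card_lt_card (Finset.ssubset_iff_of_subset ?_ |>.2 ⟨u, ?_, ?_⟩)
    · intro t
      simp only [Finset.mem_filter]
      exact fun ⟨ht, h₁, h₂⟩ => ⟨ht, h₁, htrans t ht u hu y hy h₂ huy⟩
    · simp [hu, hxu, huy]
    · simp [hirr u hu]
    · intro t
      simp only [Finset.mem_filter]
      exact fun ⟨ht, h₁, h₂⟩ => ⟨ht, htrans x hx u hu t ht hxu h₁, h₂⟩
    · simp [hu, hxu, huy]
    · simp [hirr u hu]

/-- if some pair of points on the left of `bc` is in convex
position with `bc`, then from every viewpoint `b' ∈ P_b ∪ {b}` there is such a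
pair that is angularly consecutive among `P_bc`. -/
theorem consecutive_convex_pair {n : ℕ}
    (P : Fin n → ℝ × ℝ)
    (hinj : Function.Injective P) (hgp : GenPos P)
    (a b c : Fin n) (hab : a ≠ b) (hac : a ≠ c) (hbc : b ≠ c)
    (hbca : chi P b c a = 1)
    (hempty : ∀ x : Fin n, x ≠ a → x ≠ b → x ≠ c →
      P x ∉ convexHull ℝ ({P a, P b, P c} : Set (ℝ × ℝ)))
    (hex : ∃ v w : Fin n,
      (v ≠ b ∧ v ≠ c ∧ chi P b c v = 1) ∧ (w ≠ b ∧ w ≠ c ∧ chi P b c w = 1) ∧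
      v ≠ w ∧ lineThrough (P v) (P w) ∩ segment ℝ (P b) (P c) = ∅) :
    ∀ b' : Fin n,
      ((b' ≠ a ∧ b' ≠ b ∧ b' ≠ c ∧ chi P b c b' = -1 ∧ chi P a b b' = -1) ∨ b' = b) →
      ∃ v' w' : Fin n,
        (v' ≠ b ∧ v' ≠ c ∧ chi P b c v' = 1) ∧ (w' ≠ b ∧ w' ≠ c ∧ chi P b c w' = 1) ∧
        v' ≠ w' ∧
        lineThrough (P v') (P w') ∩ segment ℝ (P b) (P c) = ∅ ∧
        ¬ ∃ u : Fin n, (u ≠ b ∧ u ≠ c ∧ chi P b c u = 1) ∧ u ≠ v' ∧ u ≠ w' ∧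
            chi P b' v' u = chi P b' v' w' ∧ chi P b' u w' = chi P b' v' w' := by
  intro b' hb'
  by_contra hcon
  have orient_self : ∀ p q : ℝ × ℝ, orient p q q = 0 := by
    intro p q
    simp only [orient, det2]
    ring
  have hΔ := chi_eq_one_iff.1 hbca
  have hkb : orient (P b) (P c) (P b) ≤ 0 := by simp [orient, det2]
  have hkc : orient (P b) (P c) (P c) ≤ 0 := (orient_self _ _).le
  have hkb' : orient (P b) (P c) (P b') ≤ 0 := by
    rcases hb' with ⟨-, -, -, h, -⟩ | rfl
    · exact (chi_eq_neg_one_iff.1 h).le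
    · exact hkb
  let S : Finset (Fin n) := Finset.univ.filter fun x => 0 < orient (P b) (P c) (P x)
  have memS : ∀ x, x ∈ S ↔ 0 < orient (P b) (P c) (P x) := by simp [S]
  have notMemS : ∀ k, orient (P b) (P c) (P k) ≤ 0 → ∀ x ∈ S, k ≠ x := by
    rintro k hk x hx rfl
    exact hk.not_gt ((memS _).1 hx)
  have memP : ∀ x ∈ S, x ≠ b ∧ x ≠ c ∧ chi P b c x = 1 := fun x hx =>
    ⟨(notMemS b hkb x hx).symm, (notMemS c hkc x hx).symm, chi_eq_one_iff.2 ((memS x).1 hx)⟩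
  have haS : a ∈ S := (memS a).2 hΔ
  have tr : ∀ k, orient (P b) (P c) (P k) ≤ 0 → ∀ x ∈ S, ∀ y ∈ S, ∀ z ∈ S,
      0 < orient (P k) (P x) (P y) → 0 < orient (P k) (P y) (P z) →
      0 < orient (P k) (P x) (P z) := fun k hk x hx y hy z hz =>
    orient_trans hk ((memS x).1 hx) ((memS y).1 hy) ((memS z).1 hz)
  have ne0 : ∀ k, orient (P b) (P c) (P k) ≤ 0 → ∀ x ∈ S, ∀ y ∈ S, x ≠ y →
      orient (P k) (P x) (P y) ≠ 0 := fun k hk x hx y hy hxy =>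
    hgp.orient_ne_zero (notMemS k hk x hx) (notMemS k hk y hy) hxy
  let C := ConsecutiveIn S fun x y => 0 < orient (P b') (P x) (P y)
  have hC : ∀ x ∈ S, ∀ y ∈ S, 0 < orient (P b') (P x) (P y) → Relation.TransGen C x y :=
    fun x hx y hy h => transGen_consecutiveIn (by simp [orient_self]) (tr b' hkb') hx hy h
  have dichotomy : ∀ x y, C x y →
      (0 < orient (P b) (P x) (P y) ∧ 0 < orient (P c) (P y) (P x)) ∨
      (0 < orient (P b) (P x) (P a) ∧ 0 < orient (P b) (P y) (P a) ∧
        0 < orient (P c) (P y) (P a)) := by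
    rintro x y ⟨hx, hy, hxy, hcons⟩
    have hne : x ≠ y := by
      rintro rfl
      simp [orient_self] at hxy
    have hmeet : (lineThrough (P x) (P y) ∩ segment ℝ (P b) (P c)).Nonempty := by
      by_contra h
      refine hcon ⟨x, y, memP x hx, memP y hy, hne, Set.not_nonempty_iff_eq_empty.1 h, ?_⟩
      rintro ⟨u, ⟨-, -, hu⟩, -, -, h₁, h₂⟩
      have h₀ := chi_eq_one_iff.2 hxy
      rw [h₀] at h₁ h₂
      exact hcons u ((memS u).2 (chi_eq_one_iff.1 hu)) (chi_eq_one_iff.1 h₁)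
        (chi_eq_one_iff.1 h₂)
    have hmul := orient_mul_nonpos_of_inter_nonempty hmeet
    have hb₀ := ne0 b hkb x hx y hy hne
    have hc₀ := ne0 c hkc x hx y hy hne
    rcases hb₀.lt_or_gt with hb | hb
    · right
      have hc : 0 < orient (P c) (P x) (P y) := by
        rcases hc₀.lt_or_gt with hc | hc
        · exact absurd (mul_pos_of_neg_of_neg hb hc) hmul.not_gt
        · exact hc
      rcases hb' with ⟨-, -, -, h₁, h₂⟩ | rfl
      · obtain ⟨hxa, hya⟩ := orient_pos_of_separates hΔ (chi_eq_neg_one_iff.1 h₁)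
          (chi_eq_neg_one_iff.1 h₂) ((memS y).1 hy) hxy hb hc
        refine ⟨hxa, hya, ?_⟩
        by_contra! h
        refine hempty y ?_ (memP y hy).1 (memP y hy).2.1
          (mem_convexHull_triple hΔ hya.le ((memS y).1 hy).le h)
        rintro rfl
        simp [orient_self] at hya
      · exact absurd hxy hb.not_gt
    · left
      refine ⟨hb, ?_⟩
      rw [orient_swap]
      rcases hc₀.lt_or_gt with hc | hc
      · linarith
      · exact absurd (mul_pos hb hc) hmul.not_gt
  have after : ∀ x, Relation.TransGen C a x → 0 < orient (P b) (P a) (P x) := by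
    intro x hx
    induction hx with
    | single h =>
      rcases dichotomy _ _ h with h' | h'
      · exact h'.1
      · simp [orient_self] at h'
    | tail _ h ih =>
      rcases dichotomy _ _ h with h' | h'
      · exact tr b hkb _ haS _ h.1 _ h.2.1 ih h'.1
      · rw [orient_swap] at ih
        linarith
  have before : ∀ x, Relation.TransGen C x a → 0 < orient (P c) (P a) (P x) := by
    intro x hx
    induction hx using Relation.TransGen.head_induction_on with
    | single h =>
      rcases dichotomy _ _ h with h' | h'
      · exact h'.2
      · simp [orient_self] at h'
    | head h _ ih =>
      rcases dichotomy _ _ h with h' | h'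
      · exact tr c hkc _ haS _ h.2.1 _ h.1 ih h'.2
      · rw [orient_swap] at ih
        linarith
  have step : ∀ x y, C x y →
      0 < orient (P b) (P x) (P y) ∧ 0 < orient (P c) (P y) (P x) := by
    intro x y h
    rcases dichotomy x y h with h' | ⟨hxa, hya, hca⟩
    · exact h'
    exfalso
    have hane : a ≠ y := by
      rintro rfl
      simp [orient_self] at hya
    rcases (ne0 b' hkb' a haS y h.2.1 hane).lt_or_gt with hlt | hgt
    · have := before y (hC y h.2.1 a haS (by rw [orient_swap]; linarith))
      rw [orient_swap] at this
      linarith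
    · have := after y (hC a haS y h.2.1 hgt)
      rw [orient_swap] at this
      linarith
  have all : ∀ x y, Relation.TransGen C x y → x ∈ S ∧ y ∈ S ∧
      0 < orient (P b) (P x) (P y) ∧ 0 < orient (P c) (P y) (P x) := by
    intro x y h
    induction h with
    | single h => exact ⟨h.1, h.2.1, step _ _ h⟩
    | tail _ h ih =>
      have hs := step _ _ h
      exact ⟨ih.1, h.2.1, tr b hkb _ ih.1 _ h.1 _ h.2.1 ih.2.2.1 hs.1,
        tr c hkc _ h.2.1 _ h.1 _ ih.1 hs.2 ih.2.2.2⟩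
  obtain ⟨v, w, ⟨-, -, hv⟩, ⟨-, -, hw⟩, hvw, hdisj⟩ := hex
  have hvS := (memS v).2 (chi_eq_one_iff.1 hv)
  have hwS := (memS w).2 (chi_eq_one_iff.1 hw)
  rcases (ne0 b' hkb' v hvS w hwS hvw).lt_or_gt with hlt | hgt
  · obtain ⟨-, -, h₁, h₂⟩ := all w v (hC w hwS v hvS (by rw [orient_swap]; linarith))
    rw [orient_swap] at h₂
    have hmeet := inter_nonempty_of_orient h₁ (neg_pos.1 h₂)
    rw [lineThrough_comm, hdisj] at hmeet
    exact Set.not_nonempty_empty hmeet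
  · obtain ⟨-, -, h₁, h₂⟩ := all v w (hC v hvS w hwS hgt)
    rw [orient_swap] at h₂
    have hmeet := inter_nonempty_of_orient h₁ (neg_pos.1 h₂)
    rw [hdisj] at hmeet
    exact Set.not_nonempty_empty hmeet
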